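/- (Move− rule) Fix an integer n ≥ 2, an orientation word o : ZMod n → ℤ with o(i) ∈ {−1, 1}, an index j ∈ ZMod n, and an even integer l with 2 ≤ l and l + 2 ≤ n. Suppose o(j−1) = −1, o(j+m) = (−1)ᵐ for m = 0,…,l−1 (an alternating sequence of length l starting with +1 at position j), and o(j+l) = −1. Then (F o)(j) = −1 and (F o)(j+1+m) = (−1)ᵐ for m = 0,…,l−1 (the alternating sequence of length l now starts at position j+1): the sequence moves one position to the right, consuming the −1 to its right and leaving a −1 to its left. -/

import Mathlib

/-- `i` is a meeting index of the orientation word `o`: `o i = 1` and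
`o (i+1) = -1`. -/
def IsMeeting {n : ℕ} (o : ZMod n → ℤ) (i : ZMod n) : Prop :=
  o i = 1 ∧ o (i + 1) = -1

instance {n : ℕ} (o : ZMod n → ℤ) (i : ZMod n) : Decidable (IsMeeting o i) := by
  unfold IsMeeting; infer_instance

/-- The round map `F`: each adjacent pair oriented `(+1, -1)` meets and both
members reverse their orientation; all other orientations are unchanged. -/
def roundMap {n : ℕ} (o : ZMod n → ℤ) : ZMod n → ℤ := fun i =>
  if IsMeeting o i then -1
  else if IsMeeting o (i - 1) then 1
  else o i

/-- The set of meeting indices of `o`. -/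
def meetSet {n : ℕ} [NeZero n] (o : ZMod n → ℤ) : Finset (ZMod n) :=
  Finset.univ.filter (IsMeeting o)

/-- The number of indices with orientation `+1`. -/
def nPlus {n : ℕ} [NeZero n] (o : ZMod n → ℤ) : ℕ :=
  (Finset.univ.filter (fun i => o i = 1)).card

/-- The number of indices with orientation `-1`. -/
def nMinus {n : ℕ} [NeZero n] (o : ZMod n → ℤ) : ℕ :=
  (Finset.univ.filter (fun i => o i = -1)).card

/-- `n_bal = min(n₊, n₋)`. -/
def nBal {n : ℕ} [NeZero n] (o : ZMod n → ℤ) : ℕ :=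
  min (nPlus o) (nMinus o)

/-- An orientation word is interlaced when its number of meeting indices equals
`n_bal`. -/
def IsInterlaced {n : ℕ} [NeZero n] (o : ZMod n → ℤ) : Prop :=
  (meetSet o).card = nBal o

theorem IsMeeting.roundMap_eq {n : ℕ} {o : ZMod n → ℤ} {i : ZMod n} (h : IsMeeting o i) :
    roundMap o i = -1 :=
  if_pos h

theorem IsMeeting.roundMap_add_one {n : ℕ} {o : ZMod n → ℤ} {i : ZMod n} (h : IsMeeting o i) :
    roundMap o (i + 1) = 1 := by
  have h_not : ¬ IsMeeting o (i + 1) := fun h' => by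
    have h1 := h'.1
    rw [h.2] at h1
    norm_num at h1
  rw [roundMap, if_neg h_not, add_sub_cancel_right, if_pos h]

theorem roundMap_add_one_of_eq_neg_one {n : ℕ} {o : ZMod n → ℤ} {i : ZMod n}
    (h : o i = -1) (h' : o (i + 1) = -1) : roundMap o (i + 1) = -1 := by
  simp [roundMap, IsMeeting, h, h']

/-- Move− rule: `- [seq, l] -` becomes `- - [seq, l]` under one
round of the dynamics: the alternating sequence moves one position right. -/
theorem roundMap_moveMinus_rule {n : ℕ} (hn : 2 ≤ n) [NeZero n]
    (o : ZMod n → ℤ) (ho : ∀ i, o i = -1 ∨ o i = 1)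
    (j : ZMod n) (l : ℕ) (hl2 : 2 ≤ l) (hle : Even l) (hln : l + 2 ≤ n)
    (hleft : o (j - 1) = -1)
    (hseq : ∀ m : ℕ, m < l → o (j + (m : ZMod n)) = (-1) ^ m)
    (hright : o (j + (l : ZMod n)) = -1) :
    roundMap o j = -1 ∧
    ∀ m : ℕ, m < l → roundMap o (j + 1 + (m : ZMod n)) = (-1) ^ m := by
  have hmeet : ∀ k : ℕ, k < l → Even k → IsMeeting o (j + (k : ZMod n)) := by
    intro k hk hke
    have hk' : k + 1 < l := by grind
    refine ⟨by rw [hseq k hk, hke.neg_one_pow], ?_⟩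
    have h := hseq (k + 1) hk'
    rwa [hke.add_one.neg_one_pow, Nat.cast_add_one, ← add_assoc] at h
  refine ⟨?_, fun m hm => ?_⟩
  · simpa using (hmeet 0 (by lia) Even.zero).roundMap_eq
  rw [add_right_comm]
  rcases Nat.even_or_odd m with hme | hmo
  · rw [hme.neg_one_pow, (hmeet m hm hme).roundMap_add_one]
  · rw [hmo.neg_one_pow]
    rcases (Nat.succ_le_of_lt hm).lt_or_eq with hlt | rfl
    · simpa [add_assoc] using (hmeet (m + 1) hlt hmo.add_one).roundMap_eq
    · refine roundMap_add_one_of_eq_neg_one (by rw [hseq m hm, hmo.neg_one_pow]) ?_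
      simpa [add_assoc] using hright
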